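/- On ℍ, with the Hwang–Singer data ρ, ξ₁, ξ₂, the Jacobian determinant satisfies the exact identity (∂ξ₁/∂H)·(∂ξ₂/∂r) − (∂ξ₂/∂H)·(∂ξ₁/∂r) = (1 + ρ)/(2ρ²·r) at every point of ℍ; in particular this determinant is strictly positive on ℍ. -/

import Mathlib

/-- Derivative of `(1/2) log u - 1/(2ρ)` along a curve. -/
theorem hasDerivAt_half_log_sub_inv {u ρ : ℝ → ℝ} {u' ρ' x : ℝ} (hu : HasDerivAt u u' x)
    (hρ : HasDerivAt ρ ρ' x) (hu0 : u x ≠ 0) (hρ0 : ρ x ≠ 0) :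
    HasDerivAt (fun t => (1/2) * Real.log (u t) - 1 / (2 * ρ t))
      (u' / (2 * u x) + ρ' / (2 * ρ x ^ 2)) x := by
  have h2 : (2 : ℝ) * ρ x ≠ 0 := mul_ne_zero two_ne_zero hρ0
  refine (((hu.log hu0).const_mul (1/2)).sub
    ((hasDerivAt_const x (1 : ℝ)).div (hρ.const_mul 2) h2)).congr_deriv ?_
  field_simp
  ring

theorem hasDerivAt_sqrt_sq_add_sq_left {H r : ℝ} (hr : 0 < r) :
    HasDerivAt (fun t => Real.sqrt (t ^ 2 + r ^ 2)) (H / Real.sqrt (H ^ 2 + r ^ 2)) H := by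
  have hpos : 0 < H ^ 2 + r ^ 2 := by positivity
  refine ((((hasDerivAt_id H).pow 2).add_const (r ^ 2)).sqrt hpos.ne').congr_deriv ?_
  have := (Real.sqrt_pos.2 hpos).ne'
  simp only [id, Pi.pow_apply]
  field_simp
  norm_num

theorem hasDerivAt_sqrt_sq_add_sq_right {H r : ℝ} (hr : 0 < r) :
    HasDerivAt (fun t => Real.sqrt (H ^ 2 + t ^ 2)) (r / Real.sqrt (H ^ 2 + r ^ 2)) r := by
  have hpos : 0 < H ^ 2 + r ^ 2 := by positivity
  refine ((((hasDerivAt_id r).pow 2).const_add (H ^ 2)).sqrt hpos.ne').congr_deriv ?_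
  have := (Real.sqrt_pos.2 hpos).ne'
  simp only [id, Pi.pow_apply]
  field_simp
  norm_num

theorem jacobian_identity {H r ρ : ℝ} (hr : 0 < r) (hρ : 0 < ρ) (hsq : ρ ^ 2 = H ^ 2 + r ^ 2)
    (h₁ : 0 < H + ρ) (h₂ : 0 < ρ - H) :
    ((1 + H / ρ) / (2 * (H + ρ)) + H / ρ / (2 * ρ ^ 2)) *
        (r / ρ / (2 * (ρ - H)) + r / ρ / (2 * ρ ^ 2)) -
      ((H / ρ - 1) / (2 * (ρ - H)) + H / ρ / (2 * ρ ^ 2)) *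
        (r / ρ / (2 * (H + ρ)) + r / ρ / (2 * ρ ^ 2)) =
      (1 + ρ) / (2 * ρ ^ 2 * r) := by
  have e₁ : (1 + H / ρ) / (2 * (H + ρ)) = 1 / (2 * ρ) := by
    field_simp
    ring
  have e₂ : (H / ρ - 1) / (2 * (ρ - H)) = -(1 / (2 * ρ)) := by
    field_simp
    ring
  have e₃ : r / ρ / (2 * (ρ - H)) = (ρ + H) / (2 * ρ * r) := by
    field_simp
    linear_combination -hsq
  have e₄ : r / ρ / (2 * (H + ρ)) = (ρ - H) / (2 * ρ * r) := by
    field_simp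
    linear_combination -hsq
  rw [e₁, e₂, e₃, e₄]
  field_simp
  linear_combination (-2 * ρ ^ 2) * hsq

/-- On `ℍ = {(H,r) : r > 0}`, with the Hwang–Singer data
`ρ = √(H²+r²)`, `ξ₁ = (1/2)log(H+ρ) − 1/(2ρ)`, `ξ₂ = (1/2)log(ρ−H) − 1/(2ρ)`, the
Jacobian determinant satisfies
`(∂ξ₁/∂H)(∂ξ₂/∂r) − (∂ξ₂/∂H)(∂ξ₁/∂r) = (1+ρ)/(2ρ²r)` at every point of `ℍ`; in
particular it is strictly positive on `ℍ`. -/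
theorem stmt_14 (ξ₁ ξ₂ : ℝ → ℝ → ℝ)
    (hξ₁ : ∀ H r : ℝ, ξ₁ H r =
      (1/2) * Real.log (H + Real.sqrt (H^2 + r^2))
        - 1 / (2 * Real.sqrt (H^2 + r^2)))
    (hξ₂ : ∀ H r : ℝ, ξ₂ H r =
      (1/2) * Real.log (Real.sqrt (H^2 + r^2) - H)
        - 1 / (2 * Real.sqrt (H^2 + r^2))) :
    ∀ H r : ℝ, 0 < r →
      (deriv (fun H' => ξ₁ H' r) H * deriv (fun r' => ξ₂ H r') r
          - deriv (fun H' => ξ₂ H' r) H * deriv (fun r' => ξ₁ H r') r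
        = (1 + Real.sqrt (H^2 + r^2)) / (2 * (Real.sqrt (H^2 + r^2))^2 * r)) ∧
      0 < deriv (fun H' => ξ₁ H' r) H * deriv (fun r' => ξ₂ H r') r
          - deriv (fun H' => ξ₂ H' r) H * deriv (fun r' => ξ₁ H r') r := by
  intro H r hr
  have hsq := Real.sq_sqrt (show 0 ≤ H ^ 2 + r ^ 2 by positivity)
  have hρ : 0 < Real.sqrt (H ^ 2 + r ^ 2) := Real.sqrt_pos.2 (by positivity)
  have habs : |H| < Real.sqrt (H ^ 2 + r ^ 2) :=
    Real.lt_sqrt_of_sq_lt (by rw [sq_abs]; nlinarith)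
  have h₁ : 0 < H + Real.sqrt (H ^ 2 + r ^ 2) := by linarith [neg_abs_le H]
  have h₂ : 0 < Real.sqrt (H ^ 2 + r ^ 2) - H := by linarith [le_abs_self H]
  have dH := hasDerivAt_sqrt_sq_add_sq_left (H := H) hr
  have dr := hasDerivAt_sqrt_sq_add_sq_right (H := H) hr
  have key : deriv (fun H' => ξ₁ H' r) H * deriv (fun r' => ξ₂ H r') r
      - deriv (fun H' => ξ₂ H' r) H * deriv (fun r' => ξ₁ H r') r
      = (1 + Real.sqrt (H^2 + r^2)) / (2 * (Real.sqrt (H^2 + r^2))^2 * r) := by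
    simp only [hξ₁, hξ₂]
    rw [(hasDerivAt_half_log_sub_inv ((hasDerivAt_id' H).fun_add dH) dH h₁.ne' hρ.ne').deriv,
      (hasDerivAt_half_log_sub_inv (dr.sub_const H) dr h₂.ne' hρ.ne').deriv,
      (hasDerivAt_half_log_sub_inv (dH.fun_sub (hasDerivAt_id' H)) dH h₂.ne' hρ.ne').deriv,
      (hasDerivAt_half_log_sub_inv (dr.const_add H) dr h₁.ne' hρ.ne').deriv]
    exact jacobian_identity hr hρ hsq h₁ h₂
  refine ⟨key, ?_⟩
  rw [key]
  positivity
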